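/- arXiv:2409.11288 — 2 statements merged into one kernel-verified Lean document; each statement's English description precedes it below -/
import Mathlib

section
/- The following are equivalent: (i) there exists ξ ∈ ℝ^{d_P} such that the derivative J_f(ξ) is not injective (f is not locally invertible); (ii) there exist y ∈ P, a nonzero t ∈ T, and a nonzero d̄ ∈ D^⊥ such that t = y ∘ d̄, i.e., t_j = y_j · d̄_j for all j. -/
open Matrix

section

variable {ι κ : Type*} [Fintype ι] [Fintype κ]

/-- A linear inequality valid at the extreme points of a compact convex set holds on the set. -/
lemma dotProduct_le_of_forall_extremePoints {s : Set (ι → ℝ)} (hs : IsCompact s)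
    (hconv : Convex ℝ s) {c : ι → ℝ} {a : ℝ} (h : ∀ x ∈ s.extremePoints ℝ, x ⬝ᵥ c ≤ a)
    {z : ι → ℝ} (hz : z ∈ s) : z ⬝ᵥ c ≤ a := by
  have hlin : IsLinearMap ℝ (fun x : ι → ℝ => x ⬝ᵥ c) :=
    ⟨fun x y => add_dotProduct x y c, fun r x => smul_dotProduct r x c⟩
  have hclosed : IsClosed {x : ι → ℝ | x ⬝ᵥ c ≤ a} :=
    isClosed_le (by unfold dotProduct; fun_prop) continuous_const
  rw [← closure_convexHull_extremePoints hs hconv] at hz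
  exact closure_minimal (convexHull_min h (convex_halfSpace_le hlin a)) hclosed hz

/-- The solutions of `A y = 0` in the standard simplex. -/
def kernelSimplex {l : Type*} (A : Matrix l ι ℝ) : Set (ι → ℝ) :=
  {y | A *ᵥ y = 0 ∧ (∀ j, 0 ≤ y j) ∧ ∑ j, y j = 1}

lemma convex_kernelSimplex {l : Type*} (A : Matrix l ι ℝ) : Convex ℝ (kernelSimplex A) := by
  rintro x ⟨hx1, hx2, hx3⟩ y ⟨hy1, hy2, hy3⟩ a b ha hb hab
  refine ⟨?_, fun j => ?_, ?_⟩
  · rw [mulVec_add, mulVec_smul, mulVec_smul, hx1, hy1]; simp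
  · exact add_nonneg (mul_nonneg ha (hx2 j)) (mul_nonneg hb (hy2 j))
  · simp [Finset.sum_add_distrib, ← Finset.mul_sum, hx3, hy3, hab]

lemma isCompact_kernelSimplex {l : Type*} (A : Matrix l ι ℝ) : IsCompact (kernelSimplex A) := by
  have hclosed : IsClosed {y : ι → ℝ | A *ᵥ y = 0} :=
    isClosed_eq (Continuous.matrix_mulVec continuous_const continuous_id) continuous_const
  exact (isCompact_stdSimplex ℝ ι).inter_left hclosed

/-- The mean of the points `v k` with weights proportional to `exp (v k ⬝ᵥ η)`. -/
noncomputable def expMean (v : κ → ι → ℝ) (η : ι → ℝ) : ι → ℝ :=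
  (∑ k, Real.exp (v k ⬝ᵥ η))⁻¹ • ∑ k, Real.exp (v k ⬝ᵥ η) • v k

lemma sum_exp_dotProduct_pos [Nonempty κ] (v : κ → ι → ℝ) (η : ι → ℝ) :
    0 < ∑ k, Real.exp (v k ⬝ᵥ η) :=
  Finset.sum_pos (fun _ _ => Real.exp_pos _) Finset.univ_nonempty

lemma sum_exp_smul_expMean [Nonempty κ] (v : κ → ι → ℝ) (η : ι → ℝ) :
    (∑ k, Real.exp (v k ⬝ᵥ η)) • expMean v η = ∑ k, Real.exp (v k ⬝ᵥ η) • v k :=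
  smul_inv_smul₀ (sum_exp_dotProduct_pos v η).ne' _

lemma sum_exp_smul_sub_expMean [Nonempty κ] (v : κ → ι → ℝ) (η : ι → ℝ) :
    ∑ k, Real.exp (v k ⬝ᵥ η) • (v k - expMean v η) = 0 := by
  simp_rw [smul_sub]
  rw [Finset.sum_sub_distrib, ← Finset.sum_smul, sum_exp_smul_expMean, sub_self]

lemma Convex.expMean_mem [Nonempty κ] {s : Set (ι → ℝ)} (hs : Convex ℝ s) {v : κ → ι → ℝ}
    (hv : ∀ k, v k ∈ s) (η : ι → ℝ) : expMean v η ∈ s :=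
  hs.centerMass_mem (t := Finset.univ) (fun _ _ => (Real.exp_pos _).le)
    (sum_exp_dotProduct_pos v η) (fun k _ => hv k)

lemma hasFDerivAt_dotProduct (c η : ι → ℝ) :
    HasFDerivAt (fun x : ι → ℝ => c ⬝ᵥ x) (dotProductBilin ℝ ℝ c).toContinuousLinearMap η :=
  (dotProductBilin ℝ ℝ c).toContinuousLinearMap.hasFDerivAt

lemma exists_hasFDerivAt_expMean [Nonempty κ] (v : κ → ι → ℝ) (η : ι → ℝ) :
    ∃ L : (ι → ℝ) →L[ℝ] (ι → ℝ), HasFDerivAt (expMean v) L η ∧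
      ∀ τ, (∑ k, Real.exp (v k ⬝ᵥ η)) • L τ =
        ∑ k, (Real.exp (v k ⬝ᵥ η) * (v k ⬝ᵥ τ)) • (v k - expMean v η) := by
  have hexp (k : κ) := (hasFDerivAt_dotProduct (v k) η).exp
  have hZ := HasFDerivAt.fun_sum (u := Finset.univ) fun k _ => hexp k
  have hS := HasFDerivAt.fun_sum (u := Finset.univ) fun k _ => (hexp k).smul_const (v k)
  have hdiff : DifferentiableAt ℝ (expMean v) η :=
    (hZ.differentiableAt.inv (sum_exp_dotProduct_pos v η).ne').smul hS.differentiableAt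
  refine ⟨fderiv ℝ (expMean v) η, hdiff.hasFDerivAt, fun τ => ?_⟩
  have hprod := hZ.smul hdiff.hasFDerivAt
  have hfun : ((fun x => ∑ k, Real.exp (v k ⬝ᵥ x)) • expMean v) =
      fun x => ∑ k, Real.exp (v k ⬝ᵥ x) • v k := funext (sum_exp_smul_expMean v)
  rw [hfun] at hprod
  have := congrArg (fun M : (ι → ℝ) →L[ℝ] (ι → ℝ) => M τ) (hprod.unique hS)
  simp only [_root_.add_apply, _root_.smul_apply,
    ContinuousLinearMap.smulRight_apply, _root_.sum_apply,
    LinearMap.coe_toContinuousLinearMap', dotProductBilin_apply_apply, smul_eq_mul] at this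
  rw [eq_sub_of_add_eq this, Finset.sum_smul, ← Finset.sum_sub_distrib]
  simp_rw [smul_sub]

/-- The derivative of `expMean` is the covariance form, which only degenerates along directions
in which the points `v k` are all level. -/
lemma dotProduct_eq_of_fderiv_expMean_eq_zero [Nonempty κ] {v : κ → ι → ℝ} {η τ d : ι → ℝ}
    (hd : (∑ k, Real.exp (v k ⬝ᵥ η)) • d =
      ∑ k, (Real.exp (v k ⬝ᵥ η) * (v k ⬝ᵥ τ)) • (v k - expMean v η))
    (hzero : d = 0) (k : κ) : v k ⬝ᵥ τ = expMean v η ⬝ᵥ τ := by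
  set μ := expMean v η ⬝ᵥ τ with hμ
  have hmean : ∑ k, Real.exp (v k ⬝ᵥ η) * (v k ⬝ᵥ τ - μ) = 0 := by
    have := congrArg (· ⬝ᵥ τ) (sum_exp_smul_sub_expMean v η)
    simpa [sum_dotProduct, smul_dotProduct, sub_dotProduct, ← hμ] using this
  have hvar : ∑ k, Real.exp (v k ⬝ᵥ η) * (v k ⬝ᵥ τ) * (v k ⬝ᵥ τ - μ) = 0 := by
    have := congrArg (· ⬝ᵥ τ) hd
    simpa [hzero, sum_dotProduct, smul_dotProduct, sub_dotProduct, ← hμ] using this.symm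
  have hsq : ∑ k, Real.exp (v k ⬝ᵥ η) * (v k ⬝ᵥ τ - μ) ^ 2 = 0 := by
    calc _ = ∑ k, Real.exp (v k ⬝ᵥ η) * (v k ⬝ᵥ τ) * (v k ⬝ᵥ τ - μ)
          - μ * ∑ k, Real.exp (v k ⬝ᵥ η) * (v k ⬝ᵥ τ - μ) := by
          rw [Finset.mul_sum, ← Finset.sum_sub_distrib]
          exact Finset.sum_congr rfl fun _ _ => by ring
      _ = 0 := by rw [hvar, hmean]; ring
  have h := (Finset.sum_eq_zero_iff_of_nonneg fun k _ =>
    mul_nonneg (Real.exp_pos (v k ⬝ᵥ η)).le (sq_nonneg _)).1 hsq k (Finset.mem_univ k)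
  have := (mul_eq_zero.1 h).resolve_left (Real.exp_pos _).ne'
  exact sub_eq_zero.1 (pow_eq_zero_iff two_ne_zero |>.1 this)

/-- If the extreme points of `s` lie below level `a` in the direction `τ`, and `s` contains a ball
of radius `ε` around `y` relative to `T ∋ τ`, then `y` lies below `a` by at least `ε * ‖τ‖`. -/
lemma dotProduct_add_mul_norm_le {s : Set (ι → ℝ)} (hs : IsCompact s) (hconv : Convex ℝ s)
    {T : Submodule ℝ (ι → ℝ)} {y : ι → ℝ} {ε : ℝ} (hε : 0 ≤ ε)
    (hball : ∀ τ ∈ T, ‖τ‖ ≤ ε → y + τ ∈ s) {τ : ι → ℝ} (hτ : τ ∈ T) {a : ℝ}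
    (h : ∀ x ∈ s.extremePoints ℝ, x ⬝ᵥ τ ≤ a) : y ⬝ᵥ τ + ε * ‖τ‖ ≤ a := by
  rcases eq_or_ne τ 0 with rfl | hne
  · simpa using dotProduct_le_of_forall_extremePoints hs hconv h
      (hball 0 T.zero_mem (by simpa using hε))
  have hpos : 0 < ‖τ‖ := norm_pos_iff.2 hne
  have hmem := hball _ (T.smul_mem (ε / ‖τ‖) hτ) (by
    rw [norm_smul, Real.norm_of_nonneg (by positivity), div_mul_cancel₀ _ hpos.ne'])
  have hle := dotProduct_le_of_forall_extremePoints hs hconv h hmem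
  rw [add_dotProduct, smul_dotProduct, smul_eq_mul] at hle
  have hself : 0 ≤ τ ⬝ᵥ τ := Finset.sum_nonneg fun j _ => mul_self_nonneg _
  have hnorm : ‖τ‖ ^ 2 ≤ τ ⬝ᵥ τ := by
    rw [← Real.sqrt_le_sqrt_iff hself, Real.sqrt_sq hpos.le]
    refine (pi_norm_le_iff_of_nonneg (Real.sqrt_nonneg _)).2 fun j => ?_
    rw [Real.norm_eq_abs]
    refine Real.abs_le_sqrt ?_
    rw [sq]
    exact Finset.single_le_sum (f := fun j => τ j * τ j) (fun j _ => mul_self_nonneg _)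
      (Finset.mem_univ j)
  have : ε * ‖τ‖ ≤ ε / ‖τ‖ * (τ ⬝ᵥ τ) := by
    rw [div_mul_eq_mul_div, le_div_iff₀ hpos]
    nlinarith
  linarith

/-- Every point in the relative interior of `s` is an exponentially weighted mean of its
extreme points, with a parameter in the direction of `s`. -/
lemma exists_expMean_eq [Nonempty κ] {s : Set (ι → ℝ)} (hs : IsCompact s) (hconv : Convex ℝ s)
    {v : κ → ι → ℝ} (hv : Set.range v = s.extremePoints ℝ)
    {T : Submodule ℝ (ι → ℝ)} {y : ι → ℝ} {ε : ℝ} (hε : 0 < ε)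
    (hball : ∀ τ ∈ T, ‖τ‖ ≤ ε → y + τ ∈ s) (hdir : ∀ x ∈ s, x - y ∈ T) :
    ∃ η ∈ T, expMean v η = y := by
  let Φ : T → ℝ := fun η => ∑ k, Real.exp ((v k - y) ⬝ᵥ (η : ι → ℝ))
  have hderiv (η : T) : HasFDerivAt Φ
      (∑ k, Real.exp ((v k - y) ⬝ᵥ (η : ι → ℝ)) •
        (dotProductBilin ℝ ℝ (v k - y)).toContinuousLinearMap.comp T.subtypeL) η :=
    HasFDerivAt.fun_sum fun k _ =>
      ((hasFDerivAt_dotProduct (v k - y) (η : ι → ℝ)).comp η T.subtypeL.hasFDerivAt).exp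
  have hcont : Continuous Φ := continuous_iff_continuousAt.2 fun η => (hderiv η).continuousAt
  have hlower (η : T) : ε * ‖η‖ ≤ Φ η := by
    obtain ⟨k₀, hk₀⟩ := Finite.exists_max fun k => v k ⬝ᵥ (η : ι → ℝ)
    have hle := dotProduct_add_mul_norm_le hs hconv hε.le hball η.2
      (a := v k₀ ⬝ᵥ (η : ι → ℝ)) (by rw [← hv]; rintro _ ⟨k, rfl⟩; exact hk₀ k)
    calc ε * ‖η‖ ≤ (v k₀ - y) ⬝ᵥ (η : ι → ℝ) := by
          rw [sub_dotProduct]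
          exact le_sub_iff_add_le'.2 hle
      _ ≤ Real.exp ((v k₀ - y) ⬝ᵥ (η : ι → ℝ)) := by
          linarith [Real.add_one_le_exp ((v k₀ - y) ⬝ᵥ (η : ι → ℝ))]
      _ ≤ Φ η := Finset.single_le_sum
          (f := fun k => Real.exp ((v k - y) ⬝ᵥ (η : ι → ℝ)))
          (fun k _ => (Real.exp_pos _).le) (Finset.mem_univ k₀)
  have hcoercive : Filter.Tendsto Φ (Filter.cocompact T) Filter.atTop :=
    Filter.tendsto_atTop_mono hlower
      ((tendsto_norm_cocompact_atTop (E := T)).const_mul_atTop hε)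
  obtain ⟨η, hη⟩ := hcont.exists_forall_le hcoercive
  have hcrit := IsLocalMin.hasFDerivAt_eq_zero (a := η)
    (Filter.Eventually.of_forall hη) (hderiv η)
  refine ⟨η, η.2, ?_⟩
  have hmem : expMean v (η : ι → ℝ) ∈ s := hconv.expMean_mem
    (fun k => extremePoints_subset (hv ▸ Set.mem_range_self k)) _
  set w := expMean v (η : ι → ℝ) with hw
  have hwT : w - y ∈ T := hdir w hmem
  have h0 : ∑ k, Real.exp ((v k - y) ⬝ᵥ (η : ι → ℝ)) * ((v k - y) ⬝ᵥ (w - y)) = 0 := by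
    simpa [sub_dotProduct, -dotProduct_sub] using
      congrArg (fun M : T →L[ℝ] ℝ => M ⟨w - y, hwT⟩) hcrit
  have h1 : ∑ k, Real.exp (v k ⬝ᵥ (η : ι → ℝ)) * ((v k - y) ⬝ᵥ (w - y)) = 0 := by
    rw [← mul_eq_zero_iff_left (Real.exp_pos (-(y ⬝ᵥ (η : ι → ℝ)))).ne', Finset.mul_sum, ← h0]
    refine Finset.sum_congr rfl fun k _ => ?_
    rw [sub_dotProduct (v k) y (η : ι → ℝ), Real.exp_sub, Real.exp_neg]
    ring
  have h2 : (∑ k, Real.exp (v k ⬝ᵥ (η : ι → ℝ))) * ((w - y) ⬝ᵥ (w - y)) = 0 := by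
    rw [← h1, ← smul_eq_mul, ← smul_dotProduct, smul_sub, hw, sum_exp_smul_expMean,
      Finset.sum_smul, ← Finset.sum_sub_distrib, sum_dotProduct]
    simp_rw [← smul_sub, smul_dotProduct, smul_eq_mul]
  have h3 := (mul_eq_zero.1 h2).resolve_left (sum_exp_dotProduct_pos v _).ne'
  exact sub_eq_zero.1 (dotProduct_self_eq_zero.1 h3)

/-- The derivative of `∏ j, x j ^ h j` in logarithmic form. -/
lemma HasFDerivAt.prod_rpow_const {E : Type*} [NormedAddCommGroup E] [NormedSpace ℝ E]
    {q : E → ι → ℝ} {q' : E →L[ℝ] (ι → ℝ)} {x : E} (hq : HasFDerivAt q q' x)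
    (hpos : ∀ x j, 0 < q x j) (h : ι → ℝ) :
    HasFDerivAt (fun x => ∏ j, Real.rpow (q x j) (h j))
      ((∏ j, Real.rpow (q x j) (h j)) •
        ∑ j, h j • (q x j)⁻¹ • (ContinuousLinearMap.proj j).comp q') x := by
  have hfun (x : E) :
      ∏ j, Real.rpow (q x j) (h j) = Real.exp (∑ j, h j * Real.log (q x j)) := by
    rw [Real.exp_sum]
    refine Finset.prod_congr rfl fun j _ => ?_
    rw [mul_comm]
    exact Real.rpow_def_of_pos (hpos x j) (h j)
  simp_rw [hfun]
  exact (HasFDerivAt.fun_sum fun j _ =>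
    (((hasFDerivAt_pi'.1 hq j).log (hpos x j).ne').const_mul (h j))).exp

end

/-- f fails to be locally invertible iff t = y ∘ d̄ for some y ∈ P and nonzero t ∈ T, d̄ ∈ D⊥. -/
theorem not_locally_invertible_iff
    (l m n dP d nP : ℕ)
    (A : Matrix (Fin l) (Fin m) ℝ) (B : Matrix (Fin n) (Fin m) ℝ)
    (T D : Submodule ℝ (Fin m → ℝ))
    (hT : ∀ y : Fin m → ℝ, y ∈ T ↔ (A.mulVec y = 0 ∧ ∑ j, y j = 0))
    (hD : ∀ y : Fin m → ℝ, y ∈ D ↔ (B.mulVec y = 0 ∧ ∑ j, y j = 0))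
    (hdP : Module.finrank ℝ T = dP) (hd : Module.finrank ℝ D = d) (hdPd : dP = d)
    (G : Matrix (Fin m) (Fin dP) ℝ) (H : Matrix (Fin m) (Fin d) ℝ)
    (hGind : LinearIndependent ℝ (fun i : Fin dP => fun j => G j i))
    (hGrange : LinearMap.range G.mulVecLin = T)
    (hHind : LinearIndependent ℝ (fun i : Fin d => fun j => H j i))
    (hHrange : LinearMap.range H.mulVecLin = D)
    (Dperp : Set (Fin m → ℝ))
    (hDperp : Dperp = {u : Fin m → ℝ | ∀ z ∈ D, ∑ j, z j * u j = 0})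
    (P : Set (Fin m → ℝ))
    (hP : P = {y : Fin m → ℝ | A.mulVec y = 0 ∧ (∀ j, 0 < y j) ∧ ∑ j, y j = 1})
    (hPne : P.Nonempty)
    (Pbar : Set (Fin m → ℝ))
    (hPbar : Pbar = {y : Fin m → ℝ | A.mulVec y = 0 ∧ (∀ j, 0 ≤ y j) ∧ ∑ j, y j = 1})
    (v : Fin nP → (Fin m → ℝ))
    (hv : Set.range v = Set.extremePoints ℝ Pbar)
    (p : (Fin dP → ℝ) → (Fin m → ℝ))
    (hp : ∀ ξ, p ξ = (∑ k, Real.exp (∑ j, v k j * G.mulVec ξ j))⁻¹ •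
        ∑ k, Real.exp (∑ j, v k j * G.mulVec ξ j) • v k)
    (f : (Fin dP → ℝ) → (Fin d → ℝ))
    (hf : ∀ ξ, f ξ = fun i => ∏ j, Real.rpow (p ξ j) (H j i))
    :
    (∃ ξ : Fin dP → ℝ, ¬ Function.Injective (fderiv ℝ f ξ)) ↔
    (∃ y ∈ P, ∃ t ∈ T, t ≠ 0 ∧
      ∃ dbar ∈ Dperp, dbar ≠ 0 ∧ ∀ j, t j = y j * dbar j) := by
  have hPbar' : Pbar = kernelSimplex A := hPbar
  have hcompact : IsCompact Pbar := hPbar' ▸ isCompact_kernelSimplex A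
  have hconv : Convex ℝ Pbar := hPbar' ▸ convex_kernelSimplex A
  have hvmem (k) : v k ∈ Pbar := extremePoints_subset (hv ▸ Set.mem_range_self k)
  have hPsub : P ⊆ Pbar := by
    rw [hP, hPbar]
    exact fun y ⟨h1, h2, h3⟩ => ⟨h1, fun j => (h2 j).le, h3⟩
  have hsub {x y : Fin m → ℝ} (hx : x ∈ Pbar) (hy : y ∈ Pbar) : x - y ∈ T := by
    rw [hPbar] at hx hy
    rw [hT, mulVec_sub, hx.1, hy.1]
    simp [hx.2.2, hy.2.2]
  have hball {y : Fin m → ℝ} (hy : y ∈ P) :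
      ∃ ε > 0, ∀ τ ∈ T, ‖τ‖ ≤ ε → y + τ ∈ Pbar := by
    rw [hP] at hy
    obtain ⟨h1, h2, h3⟩ := hy
    obtain ⟨ε, hε, hle⟩ : ∃ ε > 0, ∀ j, ε ≤ y j := by
      rcases isEmpty_or_nonempty (Fin m) with _ | _
      · exact ⟨1, one_pos, fun j => isEmptyElim j⟩
      · obtain ⟨j, hj⟩ := Finite.exists_min y
        exact ⟨y j, h2 j, hj⟩
    refine ⟨ε, hε, fun τ hτ hn => ?_⟩
    rw [hT] at hτ
    rw [hPbar]
    refine ⟨by rw [mulVec_add, h1, hτ.1, add_zero], fun j => ?_, ?_⟩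
    · have := (abs_le.1 ((norm_le_pi_norm τ j).trans hn)).1
      have := hle j
      simp only [Pi.add_apply]
      linarith
    · simp [Finset.sum_add_distrib, h3, hτ.2]
  obtain ⟨y₀, hy₀⟩ := hPne
  obtain ⟨ε, hε, hballε⟩ := hball hy₀
  have : Nonempty (Fin nP) := by
    have : (Pbar.extremePoints ℝ).Nonempty :=
      hcompact.extremePoints_nonempty ⟨y₀, hPsub hy₀⟩
    rw [← hv] at this
    exact Set.range_nonempty_iff_nonempty.1 this
  have hmemP (η) : expMean v η ∈ P := by
    have hmem := hconv.expMean_mem hvmem η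
    rw [hPbar] at hmem
    rw [hP]
    refine ⟨hmem.1, fun j => lt_of_le_of_ne (hmem.2.1 j) fun h0 => ?_, hmem.2.2⟩
    have hsum : ∑ k, Real.exp (v k ⬝ᵥ η) * v k j = 0 := by
      have := congrFun (sum_exp_smul_expMean v η) j
      simpa [← h0] using this.symm
    have hnonneg (k) : 0 ≤ v k j := by
      have := hvmem k
      rw [hPbar] at this
      exact this.2.1 j
    have hzero (k) : v k j = 0 := by
      have := (Finset.sum_eq_zero_iff_of_nonneg fun k _ =>
        mul_nonneg (Real.exp_pos (v k ⬝ᵥ η)).le (hnonneg k)).1 hsum k (Finset.mem_univ k)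
      exact (mul_eq_zero.1 this).resolve_left (Real.exp_pos _).ne'
    have hle := dotProduct_le_of_forall_extremePoints hcompact hconv (c := Pi.single j 1)
      (a := 0) (by rw [← hv]; rintro _ ⟨k, rfl⟩; simp [hzero k]) (hPsub hy₀)
    rw [hP] at hy₀
    have := hy₀.2.1 j
    simp at hle
    linarith
  have hpeq (ξ) : p ξ = expMean v (G *ᵥ ξ) := hp ξ
  have hpos (ξ j) : 0 < p ξ j := by
    have := hmemP (G *ᵥ ξ)
    rw [hP, ← hpeq] at this
    exact this.2.1 j
  have hGmem (ξ) : G *ᵥ ξ ∈ T := hGrange ▸ LinearMap.mem_range_self G.mulVecLin ξ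
  have hGsurj {η} (hη : η ∈ T) : ∃ ξ, G *ᵥ ξ = η := by
    rw [← hGrange] at hη
    exact hη
  have hGinj : Function.Injective G.mulVec := Matrix.mulVec_injective_iff.2 hGind
  choose L hL hLsum using exists_hasFDerivAt_expMean v
  have hLT (η τ) : L η τ ∈ T := by
    rw [← T.smul_mem_iff (sum_exp_dotProduct_pos v η).ne', hLsum]
    exact T.sum_mem fun k _ => T.smul_mem _ (hsub (hvmem k) (hPsub (hmemP η)))
  have hLinj (η) {τ} (hτ : τ ∈ T) (h0 : L η τ = 0) : τ = 0 := by
    have hlevel := dotProduct_eq_of_fderiv_expMean_eq_zero (hLsum η τ) h0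
    have h1 := dotProduct_add_mul_norm_le hcompact hconv hε.le hballε hτ
      (a := expMean v η ⬝ᵥ τ) (by rw [← hv]; rintro _ ⟨k, rfl⟩; exact (hlevel k).le)
    have h2 := dotProduct_add_mul_norm_le hcompact hconv hε.le hballε (T.neg_mem hτ)
      (a := expMean v η ⬝ᵥ (-τ))
      (by rw [← hv]; rintro _ ⟨k, rfl⟩; simp only [dotProduct_neg, hlevel k]; exact le_rfl)
    rw [norm_neg, dotProduct_neg, dotProduct_neg] at h2
    by_contra hne
    have := mul_pos hε (norm_pos_iff.2 hne)
    linarith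
  have hLsurj (η) {t} (ht : t ∈ T) : ∃ τ ∈ T, L η τ = t := by
    let M : T →ₗ[ℝ] T := (L η).toLinearMap.restrict fun τ _ => hLT η τ
    have hM : Function.Injective M := by
      rw [injective_iff_map_eq_zero]
      exact fun τ h => Subtype.ext (hLinj η τ.2 (congrArg Subtype.val h))
    obtain ⟨τ, hτ⟩ := LinearMap.surjective_of_injective hM ⟨t, ht⟩
    exact ⟨τ, τ.2, congrArg Subtype.val hτ⟩
  have hpderiv (ξ) :
      HasFDerivAt p ((L (G *ᵥ ξ)).comp G.mulVecLin.toContinuousLinearMap) ξ := by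
    rw [show p = expMean v ∘ G.mulVecLin.toContinuousLinearMap from funext hpeq]
    exact (hL (G *ᵥ ξ)).comp ξ G.mulVecLin.toContinuousLinearMap.hasFDerivAt
  have hfderiv (ξ τ) : fderiv ℝ f ξ τ = 0 ↔
      (fun j => L (G *ᵥ ξ) (G *ᵥ τ) j / p ξ j) ∈ Dperp := by
    have hder : HasFDerivAt f _ ξ := (hasFDerivAt_pi (φ := fun i ξ => f ξ i)).2 fun i => by
      simp_rw [hf]
      exact (hpderiv ξ).prod_rpow_const hpos fun j => H j i
    rw [hder.fderiv, hDperp, funext_iff]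
    have hprod (i) : ∏ j, p ξ j ^ H j i ≠ 0 :=
      Finset.prod_ne_zero_iff.2 fun j _ => (Real.rpow_pos_of_pos (hpos ξ j) _).ne'
    have horth (u : Fin m → ℝ) :
        (∀ i, ∑ j, H j i * u j = 0) ↔ ∀ z ∈ D, ∑ j, z j * u j = 0 := by
      rw [← hHrange]
      constructor
      · rintro h _ ⟨w, rfl⟩
        have h' : u ᵥ* H = 0 := funext fun i => by
          simpa [vecMul, dotProduct, mul_comm] using h i
        calc (H *ᵥ w) ⬝ᵥ u = u ⬝ᵥ H *ᵥ w := dotProduct_comm _ _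
          _ = 0 := by rw [dotProduct_mulVec, h', zero_dotProduct]
      · intro h i
        simpa using h _ ⟨Pi.single i 1, rfl⟩
    rw [Set.mem_ofPred_eq, ← horth]
    refine forall_congr' fun i => ?_
    simp [hprod i, div_eq_inv_mul]
  constructor
  · rintro ⟨ξ, hξ⟩
    rw [injective_iff_map_eq_zero] at hξ
    push Not at hξ
    obtain ⟨τ, h0, hne⟩ := hξ
    have ht : L (G *ᵥ ξ) (G *ᵥ τ) ≠ 0 := fun h =>
      hne (hGinj ((hLinj _ (hGmem τ) h).trans (mulVec_zero G).symm))
    have hmul (j) :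
        L (G *ᵥ ξ) (G *ᵥ τ) j = p ξ j * (L (G *ᵥ ξ) (G *ᵥ τ) j / p ξ j) :=
      (mul_div_cancel₀ _ (hpos ξ j).ne').symm
    refine ⟨p ξ, hpeq ξ ▸ hmemP _, _, hLT _ _, ht, _, (hfderiv ξ τ).1 h0, fun h => ht ?_, hmul⟩
    funext j
    rw [hmul, congrFun h j]
    simp
  · rintro ⟨y, hy, t, ht, htne, dbar, hdbar, -, hmul⟩
    obtain ⟨δ, hδ, hballδ⟩ := hball hy
    obtain ⟨η, hη, hηy⟩ := exists_expMean_eq hcompact hconv hv hδ hballδ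
      fun x hx => hsub hx (hPsub hy)
    obtain ⟨ξ, rfl⟩ := hGsurj hη
    obtain ⟨_, hτ, hτt⟩ := hLsurj (G *ᵥ ξ) ht
    obtain ⟨τ, rfl⟩ := hGsurj hτ
    have hpy : p ξ = y := (hpeq ξ).trans hηy
    refine ⟨ξ, fun hinj => htne ?_⟩
    have h0 : fderiv ℝ f ξ τ = 0 := by
      rw [hfderiv, hτt]
      convert hdbar using 1
      funext j
      rw [hmul, ← hpy, mul_div_cancel_left₀ _ (hpos ξ j).ne']
    have hτ0 : τ = 0 := hinj (h0.trans (map_zero _).symm)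
    rw [← hτt, hτ0, mulVec_zero, map_zero]
end

section
/- If the map f is not proper as a map into {z ∈ ℝ^d : z > 0}, then there exists a nonzero t ∈ T such that, with F = {x ∈ P̄ : x·t = max_{y ∈ P̄} y·t} and Z = {j ∈ {1,…,m} : x_j = 0 for all x ∈ F}, there exists a nonzero u ∈ D^⊥ with u ≥ 0 componentwise and {j : u_j > 0} = Z. -/
/-- Up to a bounded error, the logarithm of a positive combination of exponentials is the largest
exponent. -/
lemma exists_abs_log_sum_mul_exp_sub_sup'_le {ι : Type*} (s : Finset ι) (hs : s.Nonempty)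
    (w : ι → ℝ) (hw : ∀ k ∈ s, 0 < w k) :
    ∃ C, ∀ a : ι → ℝ, |Real.log (∑ k ∈ s, w k * Real.exp (a k)) - s.sup' hs a| ≤ C := by
  obtain ⟨k₀, hk₀, hmin⟩ := s.exists_min_image w hs
  have hδ : 0 < w k₀ := hw k₀ hk₀
  have hW : 0 < ∑ k ∈ s, w k := Finset.sum_pos hw hs
  refine ⟨|Real.log (w k₀)| + |Real.log (∑ k ∈ s, w k)|, fun a => ?_⟩
  obtain ⟨k₁, hk₁, hmax⟩ := s.exists_mem_eq_sup' hs a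
  have hlow : w k₀ * Real.exp (s.sup' hs a) ≤ ∑ k ∈ s, w k * Real.exp (a k) := by
    rw [hmax]
    calc w k₀ * Real.exp (a k₁) ≤ w k₁ * Real.exp (a k₁) := by gcongr; exact hmin k₁ hk₁
      _ ≤ _ := Finset.single_le_sum (f := fun k => w k * Real.exp (a k))
        (fun k hk => mul_nonneg (hw k hk).le (Real.exp_pos _).le) hk₁
  have hup : ∑ k ∈ s, w k * Real.exp (a k) ≤ (∑ k ∈ s, w k) * Real.exp (s.sup' hs a) := by
    rw [Finset.sum_mul]
    refine Finset.sum_le_sum fun k hk => ?_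
    have := (hw k hk).le
    gcongr
    exact Finset.le_sup' a hk
  have hl := Real.log_le_log (by positivity) hlow
  have hu := Real.log_le_log (lt_of_lt_of_le (by positivity) hlow) hup
  rw [Real.log_mul hδ.ne' (Real.exp_pos _).ne', Real.log_exp] at hl
  rw [Real.log_mul hW.ne' (Real.exp_pos _).ne', Real.log_exp] at hu
  rw [abs_le]
  constructor
  · linarith [neg_abs_le (Real.log (w k₀)), abs_nonneg (Real.log (∑ k ∈ s, w k))]
  · linarith [le_abs_self (Real.log (∑ k ∈ s, w k)), abs_nonneg (Real.log (w k₀))]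

/-- A continuous, positively homogeneous map that is bounded on an unbounded set vanishes at some
unit vector. -/
lemma exists_norm_eq_one_eq_zero_of_bounded_on_unbounded {E F : Type*} [NormedAddCommGroup E]
    [NormedSpace ℝ E] [ProperSpace E] [NormedAddCommGroup F] [NormedSpace ℝ F] {c : E → F}
    (hc : Continuous c) (hhom : ∀ r : ℝ, 0 < r → ∀ x, c (r • x) = r • c x) {s : Set E}
    (hs : ¬ Bornology.IsBounded s) {C : ℝ} (hC : ∀ x ∈ s, ‖c x‖ ≤ C) :
    ∃ x, ‖x‖ = 1 ∧ c x = 0 := by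
  have hex : ∀ N : ℕ, ∃ x ∈ s, (N : ℝ) + 1 < ‖x‖ := by
    intro N
    by_contra! h
    exact hs (isBounded_iff_forall_norm_le.2 ⟨_, h⟩)
  choose x hxs hx using hex
  have hpos : ∀ N, 0 < ‖x N‖ := fun N => lt_trans (by positivity) (hx N)
  have hmem : ∀ N, ‖x N‖⁻¹ • x N ∈ Metric.sphere (0 : E) 1 := by
    intro N
    rw [mem_sphere_zero_iff_norm, norm_smul, norm_inv, norm_norm,
      inv_mul_cancel₀ (hpos N).ne']
  obtain ⟨y, hy, φ, hφ, hlim⟩ := (isCompact_sphere (0 : E) 1).tendsto_subseq hmem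
  refine ⟨y, mem_sphere_zero_iff_norm.1 hy, ?_⟩
  have h₁ := (hc.tendsto y).comp hlim
  have h₂ : Filter.Tendsto (fun N : ℕ => C * ((N : ℝ) + 1)⁻¹) Filter.atTop (nhds 0) := by
    simpa using (tendsto_one_div_add_atTop_nhds_zero_nat (𝕜 := ℝ)).const_mul C
  refine tendsto_nhds_unique h₁ (squeeze_zero_norm (fun N => ?_) (h₂.comp hφ.tendsto_atTop))
  simp only [Function.comp_apply]
  rw [hhom _ (inv_pos.2 (hpos _)), norm_smul, norm_inv, norm_norm, mul_comm]
  have hC0 : 0 ≤ C := (norm_nonneg _).trans (hC _ (hxs 0))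
  gcongr
  · exact hC _ (hxs _)
  · exact (hx _).le

/-- A compact convex set with finitely many extreme points consists of the convex combinations of
these points. -/
lemma exists_convex_combination_of_range_eq_extremePoints {E ι : Type*} [Fintype ι]
    [NormedAddCommGroup E] [NormedSpace ℝ E] {s : Set E} (hs : IsCompact s)
    (hconv : Convex ℝ s) {v : ι → E} (hv : Set.range v = s.extremePoints ℝ) {x : E}
    (hx : x ∈ s) :
    ∃ c : ι → ℝ, (∀ k, 0 ≤ c k) ∧ ∑ k, c k = 1 ∧ ∑ k, c k • v k = x := by
  have hx' : x ∈ convexHull ℝ (Set.range v) := by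
    rw [← ((Set.finite_range v).isClosed_convexHull ℝ).closure_eq, hv,
      closure_convexHull_extremePoints hs hconv]
    exact hx
  have hsub : convexHull ℝ (Set.range v) ⊆
      Fintype.linearCombination ℝ v '' stdSimplex ℝ ι := by
    classical
    refine convexHull_min ?_ ((convex_stdSimplex ℝ ι).linear_image _)
    rintro _ ⟨k, rfl⟩
    exact ⟨Pi.single k 1, single_mem_stdSimplex ℝ k, by simp⟩
  obtain ⟨c, hc, hcx⟩ := hsub hx'
  exact ⟨c, hc.1, hc.2, by simpa [Fintype.linearCombination_apply] using hcx⟩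

/-- The set of probability vectors in the kernel of a matrix is compact and convex. -/
lemma isCompact_and_convex_ker_inter_stdSimplex {l m : ℕ} (A : Matrix (Fin l) (Fin m) ℝ) :
    IsCompact {y : Fin m → ℝ | A.mulVec y = 0 ∧ (∀ j, 0 ≤ y j) ∧ ∑ j, y j = 1} ∧
      Convex ℝ {y : Fin m → ℝ | A.mulVec y = 0 ∧ (∀ j, 0 ≤ y j) ∧ ∑ j, y j = 1} := by
  have heq : {y : Fin m → ℝ | A.mulVec y = 0 ∧ (∀ j, 0 ≤ y j) ∧ ∑ j, y j = 1} =
      (LinearMap.ker A.mulVecLin : Set (Fin m → ℝ)) ∩ stdSimplex ℝ (Fin m) := by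
    ext y
    simp [stdSimplex]
  rw [heq]
  exact ⟨(isCompact_stdSimplex ℝ (Fin m)).inter_left
    (Submodule.closed_of_finiteDimensional _),
    (Submodule.convex _).inter (convex_stdSimplex ℝ (Fin m))⟩

/-- A nonzero tangent direction of the simplex section `{y ≥ 0 | A y = 0, ∑ y = 1}` attains its
maximum only on points sharing a common zero coordinate. -/
lemma exists_forall_maximizer_eq_zero {l m : ℕ} (A : Matrix (Fin l) (Fin m) ℝ)
    {S : Set (Fin m → ℝ)}
    (hS : S = {y : Fin m → ℝ | A.mulVec y = 0 ∧ (∀ j, 0 ≤ y j) ∧ ∑ j, y j = 1})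
    {t : Fin m → ℝ} (htA : A.mulVec t = 0) (ht1 : ∑ j, t j = 0) (ht : t ≠ 0) :
    ∃ j, ∀ x ∈ {x ∈ S | ∀ y ∈ S, ∑ j', y j' * t j' ≤ ∑ j', x j' * t j'}, x j = 0 := by
  by_contra! h
  choose x hx hx0 using h
  have hmS : ∀ y, y ∈ S ↔ (A.mulVec y = 0 ∧ (∀ j, 0 ≤ y j) ∧ ∑ j, y j = 1) := by
    intro y; rw [hS]; rfl
  obtain ⟨j₀, hj₀⟩ := Function.ne_iff.1 ht
  have hm : (0 : ℝ) < m := by exact_mod_cast j₀.pos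
  have hconv : Convex ℝ S := by
    rw [hS]; exact (isCompact_and_convex_ker_inter_stdSimplex A).2
  set q : Fin m → ℝ := ∑ i, (m : ℝ)⁻¹ • x i with hq
  have hsum : ∑ _i : Fin m, (m : ℝ)⁻¹ = 1 := by simp [hm.ne']
  have hqS : q ∈ S := hconv.sum_mem (fun _ _ => by positivity) hsum fun i _ => (hx i).1
  have hqapp : ∀ j, q j = ∑ i, (m : ℝ)⁻¹ * x i j := by
    intro j; simp [hq, Finset.sum_apply]
  have hqpos : ∀ j, 0 < q j := by
    intro j
    rw [hqapp]
    have hnn : ∀ i, 0 ≤ x i j := fun i => ((hmS _).1 (hx i).1).2.1 j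
    refine Finset.sum_pos' (fun i _ => mul_nonneg (by positivity) (hnn i))
      ⟨j, Finset.mem_univ _, mul_pos (by positivity) ((hnn j).lt_of_ne' (hx0 j))⟩
  have hqmax : ∀ y ∈ S, ∑ j, y j * t j ≤ ∑ j, q j * t j := by
    intro y hy
    have hval : ∑ j, q j * t j = ∑ i, (m : ℝ)⁻¹ * ∑ j, x i j * t j := by
      simp_rw [hqapp, Finset.sum_mul, Finset.mul_sum]
      rw [Finset.sum_comm]
      simp_rw [mul_assoc]
    calc ∑ j, y j * t j = ∑ _i : Fin m, (m : ℝ)⁻¹ * ∑ j, y j * t j := by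
          rw [← Finset.sum_mul, hsum, one_mul]
      _ ≤ ∑ i, (m : ℝ)⁻¹ * ∑ j, x i j * t j := by
          refine Finset.sum_le_sum fun i _ => ?_
          exact mul_le_mul_of_nonneg_left ((hx i).2 y hy) (by positivity)
      _ = _ := hval.symm
  have hev : ∀ᶠ ε in nhdsWithin (0 : ℝ) (Set.Ioi 0), ∀ j, 0 < q j + ε * t j := by
    refine nhdsWithin_le_nhds (Filter.eventually_all.2 fun j => ?_)
    have hcont : Continuous fun ε : ℝ => q j + ε * t j := by fun_prop
    exact hcont.continuousAt.eventually (lt_mem_nhds (by simpa using hqpos j))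
  obtain ⟨ε, hε, hε0⟩ := (hev.and self_mem_nhdsWithin).exists
  have hqS' := (hmS _).1 hqS
  have hmem : q + ε • t ∈ S := by
    refine (hmS _).2 ⟨?_, fun j => by simpa using (hε j).le, ?_⟩
    · rw [Matrix.mulVec_add, Matrix.mulVec_smul, htA, hqS'.1]; simp
    · simp [Finset.sum_add_distrib, ← Finset.mul_sum, ht1, hqS'.2.2]
  have hle := hqmax _ hmem
  have hexp : ∑ j, (q + ε • t) j * t j = ∑ j, q j * t j + ε * ∑ j, t j * t j := by
    simp [add_mul, Finset.sum_add_distrib, Finset.mul_sum, mul_assoc]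
  have hpos : 0 < ∑ j, t j * t j :=
    Finset.sum_pos' (fun _ _ => mul_self_nonneg _)
      ⟨j₀, Finset.mem_univ _, mul_self_pos.2 hj₀⟩
  have := mul_pos (show 0 < ε from hε0) hpos
  linarith

/-- For the vertices `v` of a compact convex set in the nonnegative orthant, the best vertex value of
a linear functional exceeds the best one among the vertices with positive `j`-th coordinate exactly
when all maximizers have vanishing `j`-th coordinate. -/
lemma sup'_filter_lt_sup'_iff_forall_maximizer_eq_zero {m N : ℕ} {S : Set (Fin m → ℝ)}
    (hcomp : IsCompact S) (hconv : Convex ℝ S) (hnn : ∀ x ∈ S, ∀ j, 0 ≤ x j)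
    {v : Fin N → Fin m → ℝ} (hv : Set.range v = S.extremePoints ℝ) (j : Fin m)
    (hne : (Finset.univ.filter fun k => 0 < v k j).Nonempty)
    (hne' : (Finset.univ : Finset (Fin N)).Nonempty) (t : Fin m → ℝ) :
    (Finset.univ.filter fun k => 0 < v k j).sup' hne (fun k => ∑ i, v k i * t i) <
        Finset.univ.sup' hne' (fun k => ∑ i, v k i * t i) ↔
      ∀ x ∈ {x ∈ S | ∀ y ∈ S, ∑ i, y i * t i ≤ ∑ i, x i * t i}, x j = 0 := by
  have hvS : ∀ k, v k ∈ S := fun k => (hv ▸ Set.mem_range_self k : v k ∈ S.extremePoints ℝ).1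
  set a : Fin N → ℝ := fun k => ∑ i, v k i * t i with ha
  have hle : ∀ k, a k ≤ Finset.univ.sup' hne' a := fun k => Finset.le_sup' a (Finset.mem_univ k)
  have hcomb : ∀ x ∈ S, ∃ c : Fin N → ℝ, (∀ k, 0 ≤ c k) ∧ ∑ k, c k = 1 ∧
      ∑ k, c k • v k = x ∧ ∑ i, x i * t i = ∑ k, c k * a k := by
    intro x hx
    obtain ⟨c, hc0, hc1, hcx⟩ :=
      exists_convex_combination_of_range_eq_extremePoints hcomp hconv hv hx
    refine ⟨c, hc0, hc1, hcx, ?_⟩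
    rw [← hcx]
    simp only [ha, Finset.sum_apply, Pi.smul_apply, smul_eq_mul, Finset.sum_mul, Finset.mul_sum]
    rw [Finset.sum_comm]
    simp_rw [mul_assoc]
  constructor
  · rintro hlt x ⟨hx, hxmax⟩
    obtain ⟨c, hc0, hc1, hcx, hcv⟩ := hcomb x hx
    obtain ⟨k₁, -, hk₁⟩ := Finset.univ.exists_mem_eq_sup' hne' a
    have hge : Finset.univ.sup' hne' a ≤ ∑ k, c k * a k := by
      rw [hk₁, ← hcv]; exact hxmax _ (hvS k₁)
    have hzero : ∀ k, c k * (Finset.univ.sup' hne' a - a k) = 0 := by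
      have hs : ∑ k, c k * (Finset.univ.sup' hne' a - a k) = 0 := by
        refine le_antisymm ?_ (Finset.sum_nonneg fun k _ =>
          mul_nonneg (hc0 k) (sub_nonneg.2 (hle k)))
        simp only [mul_sub, Finset.sum_sub_distrib, ← Finset.sum_mul, hc1]
        linarith
      intro k
      exact (Finset.sum_eq_zero_iff_of_nonneg fun k _ =>
        mul_nonneg (hc0 k) (sub_nonneg.2 (hle k))).1 hs k (Finset.mem_univ k)
    rw [← hcx]
    simp only [Finset.sum_apply, Pi.smul_apply, smul_eq_mul]
    refine Finset.sum_eq_zero fun k _ => ?_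
    rcases (hnn _ (hvS k) j).eq_or_lt' with h0 | hpos
    · simp [h0]
    · have := Finset.le_sup' a
        (show k ∈ Finset.univ.filter fun k => 0 < v k j by simpa using hpos)
      rcases mul_eq_zero.1 (hzero k) with h | h
      · simp [h]
      · linarith
  · intro h
    rw [Finset.sup'_lt_iff]
    intro k hk
    refine (hle k).lt_of_ne fun heq => ?_
    refine (Finset.mem_filter.1 hk).2.ne' (h _ ⟨hvS k, fun y hy => ?_⟩)
    obtain ⟨c, hc0, hc1, -, hcv⟩ := hcomb y hy
    calc ∑ i, y i * t i = ∑ k', c k' * a k' := hcv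
      _ ≤ ∑ k', c k' * a k :=
        Finset.sum_le_sum fun k' _ => mul_le_mul_of_nonneg_left (heq ▸ hle k') (hc0 k')
      _ = a k := by rw [← Finset.sum_mul, hc1, one_mul]


/-- if f is not proper, then some face of P̄ (maximizing a nonzero t ∈ T) has its zero set realized as the support of a nonnegative nonzero vector of D⊥. -/
theorem not_proper_implies_face_sign_vector
    (l m n dP d nP : ℕ)
    (A : Matrix (Fin l) (Fin m) ℝ) (B : Matrix (Fin n) (Fin m) ℝ)
    (T D : Submodule ℝ (Fin m → ℝ))
    (hT : ∀ y : Fin m → ℝ, y ∈ T ↔ (A.mulVec y = 0 ∧ ∑ j, y j = 0))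
    (hD : ∀ y : Fin m → ℝ, y ∈ D ↔ (B.mulVec y = 0 ∧ ∑ j, y j = 0))
    (hdP : Module.finrank ℝ T = dP) (hd : Module.finrank ℝ D = d) (hdPd : dP = d)
    (G : Matrix (Fin m) (Fin dP) ℝ) (H : Matrix (Fin m) (Fin d) ℝ)
    (hGind : LinearIndependent ℝ (fun i : Fin dP => fun j => G j i))
    (hGrange : LinearMap.range G.mulVecLin = T)
    (hHind : LinearIndependent ℝ (fun i : Fin d => fun j => H j i))
    (hHrange : LinearMap.range H.mulVecLin = D)
    (Dperp : Set (Fin m → ℝ))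
    (hDperp : Dperp = {u : Fin m → ℝ | ∀ z ∈ D, ∑ j, z j * u j = 0})
    (P : Set (Fin m → ℝ))
    (hP : P = {y : Fin m → ℝ | A.mulVec y = 0 ∧ (∀ j, 0 < y j) ∧ ∑ j, y j = 1})
    (hPne : P.Nonempty)
    (Pbar : Set (Fin m → ℝ))
    (hPbar : Pbar = {y : Fin m → ℝ | A.mulVec y = 0 ∧ (∀ j, 0 ≤ y j) ∧ ∑ j, y j = 1})
    (v : Fin nP → (Fin m → ℝ))
    (hv : Set.range v = Set.extremePoints ℝ Pbar)
    (p : (Fin dP → ℝ) → (Fin m → ℝ))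
    (hp : ∀ ξ, p ξ = (∑ k, Real.exp (∑ j, v k j * G.mulVec ξ j))⁻¹ •
        ∑ k, Real.exp (∑ j, v k j * G.mulVec ξ j) • v k)
    (f : (Fin dP → ℝ) → (Fin d → ℝ))
    (hf : ∀ ξ, f ξ = fun i => ∏ j, Real.rpow (p ξ j) (H j i))
    :
    ¬ (∀ K ⊆ {z : Fin d → ℝ | ∀ i, 0 < z i}, IsCompact K → IsCompact (f ⁻¹' K)) →
      ∃ t ∈ T, t ≠ 0 ∧ ∃ u ∈ Dperp, u ≠ 0 ∧ (∀ j, 0 ≤ u j) ∧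
        {j : Fin m | 0 < u j} =
          {j : Fin m | ∀ x ∈ {x ∈ Pbar | ∀ y ∈ Pbar, ∑ j', y j' * t j' ≤ ∑ j', x j' * t j'},
            x j = 0} := by
  subst hdPd
  intro hK
  push Not at hK
  obtain ⟨K, hKpos, hKc, hfK⟩ := hK
  obtain ⟨hcomp, hconv⟩ := isCompact_and_convex_ker_inter_stdSimplex A
  rw [← hPbar] at hcomp hconv
  have hmem : ∀ y, y ∈ Pbar ↔ (A.mulVec y = 0 ∧ (∀ j, 0 ≤ y j) ∧ ∑ j, y j = 1) := by
    intro y; rw [hPbar]; rfl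
  have hnn : ∀ x ∈ Pbar, ∀ j, 0 ≤ x j := fun x hx => ((hmem x).1 hx).2.1
  have hvnn : ∀ k j, 0 ≤ v k j := fun k =>
    hnn _ (hv ▸ Set.mem_range_self k : v k ∈ Pbar.extremePoints ℝ).1
  obtain ⟨y, hy⟩ := hPne
  rw [hP] at hy
  obtain ⟨c, hc0, hc1, hcy⟩ := exists_convex_combination_of_range_eq_extremePoints hcomp hconv hv
    ((hmem y).2 ⟨hy.1, fun j => (hy.2.1 j).le, hy.2.2⟩)
  have huniv : (Finset.univ : Finset (Fin nP)).Nonempty := by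
    by_contra h
    rw [Finset.not_nonempty_iff_eq_empty] at h
    simp [h] at hc1
  have hS : ∀ j, (Finset.univ.filter fun k => 0 < v k j).Nonempty := by
    intro j
    by_contra! h
    have hzero : ∀ k, v k j = 0 := fun k =>
      le_antisymm (not_lt.1 (by simpa using Finset.filter_eq_empty_iff.1 h (Finset.mem_univ k)))
        (hvnn k j)
    have := hy.2.1 j
    rw [← hcy] at this
    simp [hzero] at this
  -- the exponents, and the piecewise linear approximation of `-log (p ξ j)`
  set a : (Fin dP → ℝ) → Fin nP → ℝ := fun ξ k => ∑ j, v k j * G.mulVec ξ j with ha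
  set u : (Fin dP → ℝ) → Fin m → ℝ := fun ξ j =>
    Finset.univ.sup' huniv (a ξ) - (Finset.univ.filter fun k => 0 < v k j).sup' (hS j) (a ξ)
    with hu
  have hGc : Continuous G.mulVec := G.mulVecLin.continuous_of_finiteDimensional
  have hac : ∀ k, Continuous fun ξ => a ξ k := by
    intro k
    refine continuous_finsetSum _ fun j _ => continuous_const.mul ?_
    exact (continuous_apply j).comp hGc
  have huc : ∀ j, Continuous fun ξ => u ξ j := fun j =>
    (Continuous.finset_sup'_apply huniv fun k _ => hac k).sub
      (Continuous.finset_sup'_apply (hS j) fun k _ => hac k)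
  have hahom : ∀ (r : ℝ) (ξ) (k), a (r • ξ) k = r * a ξ k := by
    intro r ξ k
    simp only [ha, Matrix.mulVec_smul, Pi.smul_apply, smul_eq_mul, Finset.mul_sum]
    exact Finset.sum_congr rfl fun j _ => by ring
  have huhom : ∀ r : ℝ, 0 < r → ∀ ξ j, u (r • ξ) j = r * u ξ j := by
    intro r hr ξ j
    have : a (r • ξ) = fun k => r * a ξ k := funext (hahom r ξ)
    simp only [hu, this, mul_sub]
    rw [Finset.mul₀_sup' hr.le, Finset.mul₀_sup' hr.le]
  have hpapp : ∀ ξ j, p ξ j = (∑ k, Real.exp (a ξ k))⁻¹ *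
      ∑ k ∈ Finset.univ.filter (fun k => 0 < v k j), v k j * Real.exp (a ξ k) := by
    intro ξ j
    rw [hp, Finset.sum_filter_of_ne fun k _ hk => (hvnn k j).lt_of_ne' (left_ne_zero_of_mul hk)]
    simp [ha, Finset.sum_apply, mul_comm]
  have hden : ∀ ξ, 0 < ∑ k, Real.exp (a ξ k) := fun ξ =>
    Finset.sum_pos (fun k _ => Real.exp_pos _) huniv
  have hnum : ∀ ξ j,
      0 < ∑ k ∈ Finset.univ.filter (fun k => 0 < v k j), v k j * Real.exp (a ξ k) := fun ξ j =>
    Finset.sum_pos (fun k hk => mul_pos (Finset.mem_filter.1 hk).2 (Real.exp_pos _)) (hS j)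
  have hppos : ∀ ξ j, 0 < p ξ j := fun ξ j => by
    rw [hpapp]; exact mul_pos (inv_pos.2 (hden ξ)) (hnum ξ j)
  have hpc : ∀ j, Continuous fun ξ => p ξ j := by
    intro j
    simp only [hpapp]
    refine Continuous.mul (Continuous.inv₀ ?_ fun ξ => (hden ξ).ne') ?_
    · exact continuous_finsetSum _ fun k _ => Real.continuous_exp.comp (hac k)
    · exact continuous_finsetSum _ fun k _ =>
        continuous_const.mul (Real.continuous_exp.comp (hac k))
  have hlogp : ∀ j, ∃ C, ∀ ξ, |Real.log (p ξ j) + u ξ j| ≤ C := by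
    intro j
    obtain ⟨C₁, hC₁⟩ := exists_abs_log_sum_mul_exp_sub_sup'_le Finset.univ huniv (fun _ => 1)
      fun _ _ => one_pos
    obtain ⟨C₂, hC₂⟩ := exists_abs_log_sum_mul_exp_sub_sup'_le _ (hS j) (fun k => v k j)
      fun k hk => (Finset.mem_filter.1 hk).2
    refine ⟨C₁ + C₂, fun ξ => ?_⟩
    have h₁ := abs_le.1 (hC₁ (a ξ))
    have h₂ := abs_le.1 (hC₂ (a ξ))
    simp only [one_mul] at h₁
    rw [hpapp, Real.log_mul (inv_pos.2 (hden ξ)).ne' (hnum ξ j).ne', Real.log_inv, abs_le]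
    simp only [hu]
    constructor <;> linarith [h₁.1, h₁.2, h₂.1, h₂.2]
  choose C hC using hlogp
  have hfc : Continuous f := by
    refine continuous_pi fun i => ?_
    simp only [hf]
    exact continuous_finsetProd _ fun j _ =>
      (hpc j).rpow_const fun ξ => Or.inl (hppos ξ j).ne'
  have hunb : ¬ Bornology.IsBounded (f ⁻¹' K) := fun hb =>
    hfK (Metric.isCompact_of_isClosed_isBounded (hKc.isClosed.preimage hfc) hb)
  have hlogf : ∀ ξ i, Real.log (f ξ i) = ∑ j, H j i * Real.log (p ξ j) := by
    intro ξ i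
    rw [hf]
    change Real.log (∏ j, p ξ j ^ H j i) = _
    rw [Real.log_prod fun j _ => (Real.rpow_pos_of_pos (hppos ξ j) _).ne']
    exact Finset.sum_congr rfl fun j _ => Real.log_rpow (hppos ξ j) _
  have hlogK : ∀ i, ∃ R, ∀ z ∈ K, |Real.log (z i)| ≤ R := by
    intro i
    obtain ⟨R, hR⟩ := hKc.exists_bound_of_continuousOn (f := fun z => Real.log (z i))
      ((continuous_apply i).continuousOn.log fun z hz => (hKpos hz i).ne')
    exact ⟨R, hR⟩
  choose R hR using hlogK
  have hbound : ∀ ξ ∈ f ⁻¹' K, ‖Matrix.vecMul (u ξ) H‖ ≤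
      ∑ i, (|R i| + ∑ j, |H j i| * C j) := by
    intro ξ hξ
    have hC0 : ∀ j, 0 ≤ C j := fun j => (abs_nonneg _).trans (hC j 0)
    have hterm : ∀ i, 0 ≤ |R i| + ∑ j, |H j i| * C j := fun i =>
      add_nonneg (abs_nonneg _)
        (Finset.sum_nonneg fun j _ => mul_nonneg (abs_nonneg _) (hC0 j))
    rw [pi_norm_le_iff_of_nonneg (Finset.sum_nonneg fun i _ => hterm i)]
    intro i
    refine le_trans ?_ (Finset.single_le_sum (fun i _ => hterm i) (Finset.mem_univ i))
    have hval : Matrix.vecMul (u ξ) H i =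
        ∑ j, H j i * (Real.log (p ξ j) + u ξ j) - Real.log (f ξ i) := by
      rw [hlogf, ← Finset.sum_sub_distrib]
      change ∑ j, u ξ j * H j i = _
      exact Finset.sum_congr rfl fun j _ => by ring
    rw [hval, Real.norm_eq_abs]
    have h₁ : |∑ j, H j i * (Real.log (p ξ j) + u ξ j)| ≤ ∑ j, |H j i| * C j := by
      refine (Finset.abs_sum_le_sum_abs _ _).trans (Finset.sum_le_sum fun j _ => ?_)
      rw [abs_mul]
      exact mul_le_mul_of_nonneg_left (hC j ξ) (abs_nonneg _)
    have h₂ := (hR i _ hξ).trans (le_abs_self (R i))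
    linarith [abs_sub (∑ j, H j i * (Real.log (p ξ j) + u ξ j)) (Real.log (f ξ i))]
  obtain ⟨ξ, hξ1, hξ0⟩ := exists_norm_eq_one_eq_zero_of_bounded_on_unbounded
    (c := fun ξ => Matrix.vecMul (u ξ) H)
    ((continuous_pi huc).matrix_vecMul continuous_const)
    (fun r hr x => by
      rw [← Matrix.smul_vecMul]
      exact congrArg (Matrix.vecMul · H) (funext fun j => huhom r hr x j))
    hunb hbound
  have hξT : G.mulVec ξ ∈ T := by
    rw [← hGrange]; exact ⟨ξ, rfl⟩
  have hξne : G.mulVec ξ ≠ 0 := by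
    intro h
    have : ξ = 0 := Matrix.mulVec_injective_iff.2 hGind (h.trans (Matrix.mulVec_zero G).symm)
    simp [this] at hξ1
  have hsupp : ∀ j, 0 < u ξ j ↔
      ∀ x ∈ {x ∈ Pbar | ∀ y ∈ Pbar, ∑ j', y j' * G.mulVec ξ j' ≤ ∑ j', x j' * G.mulVec ξ j'},
        x j = 0 := fun j => sub_pos.trans
    (sup'_filter_lt_sup'_iff_forall_maximizer_eq_zero hcomp hconv hnn hv j (hS j) huniv _)
  have hTξ := (hT _).1 hξT
  obtain ⟨j₀, hj₀⟩ := exists_forall_maximizer_eq_zero A hPbar hTξ.1 hTξ.2 hξne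
  refine ⟨G.mulVec ξ, hξT, hξne, u ξ, ?_, ?_, ?_, Set.ext hsupp⟩
  · rw [hDperp]
    intro z hz
    rw [← hHrange] at hz
    obtain ⟨w, rfl⟩ := hz
    change dotProduct (H.mulVec w) (u ξ) = 0
    rw [dotProduct_comm, Matrix.dotProduct_mulVec]
    rw [hξ0, zero_dotProduct]
  · intro h
    exact ((hsupp j₀).2 hj₀).ne' (congrFun h j₀)
  · exact fun j => sub_nonneg.2 (Finset.sup'_mono _ (Finset.filter_subset _ _) _)
end
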